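/- Suppose X is compact metrizable, G countable discrete acting on X, and fix k, l ∈ ℕ. The following are equivalent: (i) for any a = (f_1,...,f_k), b = (g_1,...,g_l) ∈ K(X,G), if (n+1)[a] ≤ n[b] in W(X,G) for some n ∈ ℕ⁺, then [a] ≤ [b]; (ii) for any such a, b with A_i = supp(f_i), B_j = supp(g_j), if ⋃_i A_i ⊆ G·(⋃_j B_j) and Σ_i μ(A_i) < Σ_j μ(B_j) for every μ ∈ Pr_G(X) with Σ_j μ(B_j) = 1, then a ≼ b. -/

import Mathlib

open scoped Pointwise NNReal ENNReal

variable {X : Type*} [TopologicalSpace X] {G : Type*} [Group G] [MulAction G X]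

/-- The open support of a continuous `ℝ≥0`-valued function. -/
def osupp (f : C(X, ℝ≥0)) : Set X := {x | f x ≠ 0}

/-- Dynamical subequivalence `A ≼ B` for two finite tuples (lists) of subsets of `X`. -/
def SetSubeq (G : Type*) [Group G] [MulAction G X] (A B : List (Set X)) : Prop :=
  ∀ F : Fin A.length → Set X,
    (∀ i, IsClosed (F i) ∧ F i ⊆ A.get i) →
    ∃ (J : Fin A.length → ℕ)
      (U : (i : Fin A.length) → Fin (J i) → Set X)
      (s : (i : Fin A.length) → Fin (J i) → G)
      (k : (i : Fin A.length) → Fin (J i) → Fin B.length),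
      (∀ i j, IsOpen (U i j)) ∧
      (∀ i, F i ⊆ ⋃ j, U i j) ∧
      (∀ i j, (s i j) • U i j ⊆ B.get (k i j)) ∧
      (∀ (p q : Σ i : Fin A.length, Fin (J i)), p ≠ q → k p.1 p.2 = k q.1 q.2 →
        Disjoint ((s p.1 p.2) • U p.1 p.2) ((s q.1 q.2) • U q.1 q.2))

/-- Dynamical subequivalence `a ≼ b` for tuples of nonnegative continuous functions. -/
def DynSubeq (G : Type*) [Group G] [MulAction G X] (a b : List C(X, ℝ≥0)) : Prop :=
  SetSubeq G (a.map osupp) (b.map osupp)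

/-- The entrywise cut-down `(f - ε)₊`. -/
noncomputable def cutFun (f : C(X, ℝ≥0)) (ε : ℝ≥0) : C(X, ℝ≥0) :=
  ⟨fun x => f x - ε, f.continuous.sub continuous_const⟩

noncomputable def cutList (a : List C(X, ℝ≥0)) (ε : ℝ≥0) : List C(X, ℝ≥0) := a.map (cutFun · ε)

/-- Membership in the algebra of sets generated by the open sets of `X`. -/
def InAlg (X : Type*) [TopologicalSpace X] (s : Set X) : Prop :=
  s ∈ MeasureTheory.generateSetAlgebra {t : Set X | IsOpen t}

/-- A `G`-invariant regular premeasure on the algebra generated by the open sets. -/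
structure InvRegPremeasure (X : Type*) [TopologicalSpace X] (G : Type*) [Group G]
    [MulAction G X] where
  m : Set X → ℝ≥0∞
  junk : ∀ s : Set X, ¬ InAlg X s → m s = 0
  empty' : m ∅ = 0
  countably_additive : ∀ A : ℕ → Set X, (∀ n, InAlg X (A n)) →
    Pairwise (Function.onFun Disjoint A) → InAlg X (⋃ n, A n) →
    m (⋃ n, A n) = ∑' n, m (A n)
  invariant : ∀ (g : G) (s : Set X), InAlg X s → m (g • s) = m s
  inner_regular : ∀ s : Set X, InAlg X s →
    m s = ⨆ (F : Set X) (_ : IsCompact F ∧ F ⊆ s), m F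
  outer_regular : ∀ s : Set X, InAlg X s →
    m s = ⨅ (O : Set X) (_ : IsOpen O ∧ s ⊆ O), m O

/-- A state on the generalized type semigroup `W(X, G)`, described at the level of
`K(X, G)`: a function on tuples which is monotone for `≼`, additive for concatenation,
and vanishes on the empty tuple. -/
structure DynState (X : Type*) [TopologicalSpace X] (G : Type*) [Group G]
    [MulAction G X] where
  toFun : List C(X, ℝ≥0) → ℝ≥0∞
  mono : ∀ a b, DynSubeq G a b → toFun a ≤ toFun b
  additive : ∀ a b, toFun (a ++ b) = toFun a + toFun b
  zero' : toFun [] = 0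

/-- Lower semicontinuity of a state. -/
def DynState.LSC (D : DynState X G) : Prop :=
  ∀ a, D.toFun a = ⨆ (ε : ℝ≥0) (_ : 0 < ε), D.toFun (cutList a ε)


/-- Sublinear functionals, monotone for `r` and additive in the direction of the unit `y`. -/
structure IsUnitalSublinear {W : Type*} [AddCommMonoid W] (r : W → W → Prop) (y : W)
    (q : W → ℝ) : Prop where
  nonneg : ∀ a, 0 ≤ q a
  mono : ∀ a b, r a b → q a ≤ q b
  add_le : ∀ a b, q (a + b) ≤ q a + q b
  le_nsmul : ∀ (n : ℕ) a, n * q a ≤ q (n • a)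
  add_unit : ∀ a, q (a + y) = q a + 1

namespace IsUnitalSublinear

variable {W : Type*} [AddCommMonoid W] {r : W → W → Prop} {y : W} {q : W → ℝ}

theorem map_zero (h : IsUnitalSublinear r y q) : q 0 = 0 := by
  have h1 := h.le_nsmul 2 0
  have h2 := h.nonneg 0
  simp only [smul_zero] at h1
  push_cast at h1
  linarith

theorem nsmul_le (h : IsUnitalSublinear r y q) (n : ℕ) (a : W) : q (n • a) ≤ n * q a := by
  induction n with
  | zero => simp [h.map_zero]
  | succ n ih =>
    rw [succ_nsmul]
    push_cast
    linarith [h.add_le (n • a) a]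

theorem tilt (h : IsUnitalSublinear r y q) (refl : ∀ a, r a a)
    (add : ∀ a b c d, r a b → r c d → r (a + c) (b + d)) (zero : ∀ a, r 0 a) (z : W) :
    IsUnitalSublinear r y (fun w => ⨅ n : ℕ, (q (w + n • z) - n * q z)) := by
  have lb : ∀ w (n : ℕ), 0 ≤ q (w + n • z) - n * q z := by
    intro w n
    have h1 : r (0 + n • z) (w + n • z) := add _ _ _ _ (zero w) (refl _)
    rw [zero_add] at h1
    linarith [h.mono _ _ h1, h.le_nsmul n z]
  have bdd : ∀ w, BddBelow (Set.range fun n : ℕ => q (w + n • z) - n * q z) := by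
    intro w
    exact ⟨0, by rintro _ ⟨n, rfl⟩; exact lb w n⟩
  refine ⟨fun a => le_ciInf (lb a), fun a b hab => ?_, fun a b => ?_, fun m a => ?_, fun a => ?_⟩
  · refine le_ciInf fun n => (ciInf_le (bdd a) n).trans ?_
    linarith [h.mono _ _ (add _ _ _ _ hab (refl (n • z)))]
  · refine le_ciInf_add_ciInf fun n m => (ciInf_le (bdd (a + b)) (n + m)).trans ?_
    have := h.add_le (a + n • z) (b + m • z)
    rw [show a + n • z + (b + m • z) = a + b + (n + m) • z by rw [add_nsmul]; abel] at this
    push_cast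
    linarith
  · rcases Nat.eq_zero_or_pos m with rfl | hm
    · simpa using le_ciInf (lb 0)
    refine le_ciInf fun n => ?_
    have h1 := ciInf_le (bdd a) n
    have h2 := h.le_nsmul m (a + n • z)
    have h3 := h.add_le (m • a + n • z) (((m - 1) * n) • z)
    have h4 := h.nsmul_le ((m - 1) * n) z
    have hmn : m * n = n + (m - 1) * n := by
      obtain ⟨k, rfl⟩ : ∃ k, m = k + 1 := ⟨m - 1, by omega⟩
      simp; ring
    have e : m • a + n • z + ((m - 1) * n) • z = m • (a + n • z) := by
      rw [add_assoc, ← add_nsmul, ← hmn, smul_add, mul_nsmul']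
    rw [e] at h3
    have hc : (m : ℝ) * n = n + ((m - 1) * n : ℕ) := by exact_mod_cast hmn
    have h5 := mul_le_mul_of_nonneg_left h1 (Nat.cast_nonneg (α := ℝ) m)
    have h6 : (m : ℝ) * (q (a + n • z) - n * q z) = m * q (a + n • z) - (m * n) * q z := by ring
    rw [h6, hc, add_mul] at h5
    linarith
  · have : ∀ n : ℕ, q (a + y + n • z) - n * q z = (q (a + n • z) - n * q z) + 1 := by
      intro n
      rw [show a + y + n • z = a + n • z + y by abel, h.add_unit]
      ring
    simp only [this]
    rw [ciInf_add (bdd a)]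

theorem iInf_chain {c : Set (W → ℝ)} (hc : IsChain (· ≤ ·) c) (hne : c.Nonempty)
    (h : ∀ q ∈ c, IsUnitalSublinear r y q) :
    IsUnitalSublinear r y (fun w => ⨅ q : c, q.1 w) ∧
      ∀ q ∈ c, (fun w => ⨅ q : c, q.1 w) ≤ q := by
  have : Nonempty c := hne.to_subtype
  have bdd : ∀ w, BddBelow (Set.range fun q : c => q.1 w) := by
    intro w
    exact ⟨0, by rintro _ ⟨q, rfl⟩; exact (h q q.2).nonneg w⟩
  refine ⟨⟨fun a => le_ciInf fun q => (h q q.2).nonneg a, fun a b hab => ?_, fun a b => ?_,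
    fun n a => ?_, fun a => ?_⟩, fun q hq w => ciInf_le (bdd w) ⟨q, hq⟩⟩
  · exact le_ciInf fun q => (ciInf_le (bdd a) q).trans ((h q q.2).mono _ _ hab)
  · refine le_ciInf_add_ciInf fun p q => ?_
    rcases hc.total p.2 q.2 with hpq | hpq
    · exact (ciInf_le (bdd _) p).trans
        (((h p p.2).add_le a b).trans (add_le_add le_rfl (hpq b)))
    · exact (ciInf_le (bdd _) q).trans
        (((h q q.2).add_le a b).trans (add_le_add (hpq a) le_rfl))
  · refine le_ciInf fun q => le_trans ?_ ((h q q.2).le_nsmul n a)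
    exact mul_le_mul_of_nonneg_left (ciInf_le (bdd a) q) (Nat.cast_nonneg n)
  · have : ∀ q : c, q.1 (a + y) = q.1 a + 1 := fun q => (h q q.2).add_unit a
    simp only [this]
    rw [ciInf_add (bdd a)]

/-- A minimal unital sublinear functional is additive. -/
theorem exists_additive (h : IsUnitalSublinear r y q) (refl : ∀ a, r a a)
    (add : ∀ a b c d, r a b → r c d → r (a + c) (b + d)) (zero : ∀ a, r 0 a) :
    ∃ D : W →+ ℝ, (∀ a b, r a b → D a ≤ D b) ∧ D y = 1 := by
  obtain ⟨p, -, hp⟩ := zorn_le_nonempty₀ (α := (W → ℝ)ᵒᵈ)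
    {q | IsUnitalSublinear r y (OrderDual.ofDual q)} (fun c hcs hc p hp => by
      obtain ⟨h1, h2⟩ := iInf_chain (r := r) (y := y) (c := OrderDual.toDual ⁻¹' c)
        (fun a ha b hb hab => (hc ha hb hab).symm) ⟨p, hp⟩ (fun q hq => hcs hq)
      exact ⟨OrderDual.toDual _, h1, fun z hz => h2 z hz⟩) (OrderDual.toDual q) h
  have hP : IsUnitalSublinear r y (OrderDual.ofDual p) := hp.1
  set P : W → ℝ := OrderDual.ofDual p
  have hmin : ∀ q, IsUnitalSublinear r y q → q ≤ P → P ≤ q := fun q hq hle => hp.2 hq hle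
  have hadd : ∀ a z, P (a + z) = P a + P z := by
    intro a z
    refine le_antisymm (hP.add_le a z) ?_
    have bdd : ∀ w, BddBelow (Set.range fun n : ℕ => P (w + n • z) - n * P z) := by
      intro w
      refine ⟨0, ?_⟩
      rintro _ ⟨n, rfl⟩
      have h1 : r (0 + n • z) (w + n • z) := add _ _ _ _ (zero w) (refl _)
      rw [zero_add] at h1
      have := hP.mono _ _ h1
      have := hP.le_nsmul n z
      simp only
      linarith
    have h1 := hmin _ (hP.tilt refl add zero z) (fun w => by
      simpa using ciInf_le (bdd w) 0) a
    have h2 := ciInf_le (bdd a) 1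
    simp only [one_smul, Nat.cast_one, one_mul] at h1 h2
    linarith
  refine ⟨⟨⟨P, hP.map_zero⟩, hadd⟩, hP.mono, ?_⟩
  have := hP.add_unit 0
  rw [hP.map_zero, zero_add, zero_add] at this
  exact this

end IsUnitalSublinear

section States

variable {W : Type*} [AddCommMonoid W] {r : W → W → Prop}

theorem nsmul_rel (add : ∀ a b c d, r a b → r c d → r (a + c) (b + d)) (zero : ∀ a, r 0 a)
    {a b : W} (h : r a b) (n : ℕ) : r (n • a) (n • b) := by
  induction n with
  | zero => simpa using zero _
  | succ n ih => rw [succ_nsmul, succ_nsmul]; exact add _ _ _ _ ih h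

theorem nsmul_rel_of_le (refl : ∀ a, r a a)
    (add : ∀ a b c d, r a b → r c d → r (a + c) (b + d)) (zero : ∀ a, r 0 a)
    (a : W) {m n : ℕ} (h : m ≤ n) : r (m • a) (n • a) := by
  obtain ⟨k, rfl⟩ := Nat.exists_eq_add_of_le h
  have := add _ _ _ _ (refl (m • a)) (zero (k • a))
  rwa [add_zero, ← add_nsmul] at this

/-- A preordered monoid with an order unit `y` none of whose multiples is absorbing has a state. -/
theorem exists_state_of_unit (refl : ∀ a, r a a) (trans : ∀ a b c, r a b → r b c → r a c)
    (add : ∀ a b c d, r a b → r c d → r (a + c) (b + d)) (zero : ∀ a, r 0 a)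
    (y : W) (unit : ∀ w, ∃ n : ℕ, r w (n • y)) (hy : ∀ n : ℕ, ¬ r ((n + 1) • y) (n • y)) :
    ∃ D : W →+ ℝ, (∀ a b, r a b → D a ≤ D b) ∧ D y = 1 := by
  let S : W → Set ℝ := fun w =>
    {t | ∃ M K N : ℕ, 0 < M ∧ r (M • w + K • y) (N • y) ∧ t * M = (N : ℝ) - K}
  have lb : ∀ w, ∀ t ∈ S w, 0 ≤ t := by
    rintro w t ⟨M, K, N, hM, h, ht⟩
    have hKN : K ≤ N := by
      by_contra! hlt
      have h1 := add _ _ _ _ (zero (M • w)) (refl (K • y))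
      rw [zero_add] at h1
      exact hy N (trans _ _ _ (nsmul_rel_of_le refl add zero y hlt) (trans _ _ _ h1 h))
    have hKN' : (K : ℝ) ≤ N := by exact_mod_cast hKN
    have hM' : (0 : ℝ) < M := by exact_mod_cast hM
    by_contra! hneg
    nlinarith
  have bdd : ∀ w, BddBelow (S w) := fun w => ⟨0, fun t ht => lb w t ht⟩
  have ne : ∀ w, (S w).Nonempty := by
    intro w
    obtain ⟨n, hn⟩ := unit w
    exact ⟨n, 1, 0, n, one_pos, by simpa using hn, by simp⟩
  have key : IsUnitalSublinear r y (fun w => sInf (S w)) := by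
    refine ⟨fun a => le_csInf (ne a) (lb a), fun a b hab => ?_, fun a b => ?_, fun m a => ?_,
      fun a => ?_⟩
    · refine csInf_le_csInf (bdd a) (ne b) ?_
      rintro t ⟨M, K, N, hM, h, ht⟩
      exact ⟨M, K, N, hM,
        trans _ _ _ (add _ _ _ _ (nsmul_rel add zero hab M) (refl _)) h, ht⟩
    · rw [← csInf_add (ne a) (bdd a) (ne b) (bdd b)]
      refine csInf_le_csInf (bdd _) ((ne a).add (ne b)) ?_
      rintro _ ⟨t, ⟨M, K, N, hM, h, ht⟩, u, ⟨M', K', N', hM', h', hu⟩, rfl⟩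
      refine ⟨M * M', M' * K + M * K', M' * N + M * N', Nat.mul_pos hM hM', ?_, ?_⟩
      · have := add _ _ _ _ (nsmul_rel add zero h M') (nsmul_rel add zero h' M)
        convert this using 1
        · simp only [smul_add, add_nsmul, mul_nsmul]
          rw [nsmul_left_comm a M M', nsmul_left_comm b M' M, nsmul_left_comm y M K',
            nsmul_left_comm y M' K]
          abel
        · simp only [add_nsmul, mul_nsmul]
          rw [nsmul_left_comm y M' N, nsmul_left_comm y M N']
      · push_cast
        linear_combination (M' : ℝ) * ht + (M : ℝ) * hu
    · rcases Nat.eq_zero_or_pos m with rfl | hm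
      · simpa using le_csInf (ne 0) (lb 0)
      refine le_csInf (ne _) ?_
      rintro t ⟨M, K, N, hM, h, ht⟩
      have hm' : (0 : ℝ) < m := by exact_mod_cast hm
      have : t / m ∈ S a := by
        refine ⟨M * m, K, N, Nat.mul_pos hM hm, ?_, ?_⟩
        · rwa [mul_nsmul']
        · push_cast
          rw [← ht]
          field_simp
      have := csInf_le (bdd a) this
      rwa [le_div_iff₀ hm', mul_comm] at this
    · refine le_antisymm ?_ ?_
      · rw [← sub_le_iff_le_add]
        refine le_csInf (ne a) ?_
        rintro t ⟨M, K, N, hM, h, ht⟩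
        rw [sub_le_iff_le_add]
        refine csInf_le (bdd _) ⟨M, K, N + M, hM, ?_, ?_⟩
        · have := add _ _ _ _ h (refl (M • y))
          convert this using 1
          · rw [smul_add]; abel
          · rw [add_nsmul]
        · push_cast
          linear_combination ht
      · refine le_csInf (ne _) ?_
        rintro t ⟨M, K, N, hM, h, ht⟩
        rw [← le_sub_iff_add_le]
        refine csInf_le (bdd _) ⟨M, M + K, N, hM, ?_, ?_⟩
        · convert h using 1
          rw [smul_add, add_nsmul]; abel
        · push_cast
          linear_combination ht
  exact key.exists_additive refl add zero

/-- If `(n + 1) x ≤ n y` for no positive `n`, some state normalized at the order unit `y` is at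
least `1` at `x`. -/
theorem exists_state_one_le (refl : ∀ a, r a a) (trans : ∀ a b c, r a b → r b c → r a c)
    (add : ∀ a b c d, r a b → r c d → r (a + c) (b + d)) (zero : ∀ a, r 0 a)
    (x y : W) (unit : ∀ w, ∃ n : ℕ, r w (n • y))
    (hxy : ∀ n : ℕ, 0 < n → ¬ r ((n + 1) • x) (n • y)) :
    ∃ D : W →+ ℝ, (∀ a b, r a b → D a ≤ D b) ∧ D y = 1 ∧ 1 ≤ D x := by
  let r' : W → W → Prop := fun u v => ∃ n : ℕ, r (u + n • x) (v + n • y)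
  have hr : ∀ a b, r a b → r' a b := fun a b h => ⟨0, by simpa using h⟩
  have add' : ∀ a b c d, r' a b → r' c d → r' (a + c) (b + d) := by
    rintro a b c d ⟨n, hn⟩ ⟨m, hm⟩
    refine ⟨n + m, ?_⟩
    have := add _ _ _ _ hn hm
    convert this using 1 <;> rw [add_nsmul] <;> abel
  have trans' : ∀ a b c, r' a b → r' b c → r' a c := by
    rintro a b c ⟨n, hn⟩ ⟨m, hm⟩
    refine ⟨n + m, trans _ (b + m • x + n • y) _ ?_ ?_⟩
    · have := add _ _ _ _ hn (refl (m • x))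
      convert this using 1
      · rw [add_nsmul]; abel
      · abel
    · have := add _ _ _ _ hm (refl (n • y))
      convert this using 1
      rw [add_nsmul]; abel
  obtain ⟨D, hD, hDy⟩ := exists_state_of_unit (r := r') (fun a => hr _ _ (refl a)) trans' add'
    (fun a => hr _ _ (zero a)) y (fun w => (unit w).imp fun n hn => hr _ _ hn) (by
      rintro N ⟨n, h⟩
      obtain ⟨m, hm⟩ := unit x
      replace hm : r x ((m + 1) • y) :=
        trans _ _ _ hm (nsmul_rel_of_le refl add zero y (Nat.le_succ m))
      have iter : ∀ k : ℕ, r (N • y + k • (y + n • x)) (N • y + (k * n) • y) := by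
        intro k
        induction k with
        | zero => simpa using refl _
        | succ k ih =>
          have h1 := add _ _ _ _ ih (refl (y + n • x))
          have h2 := add _ _ _ _ h (refl ((k * n) • y))
          refine trans _ (N • y + (k * n) • y + (y + n • x)) _ ?_
            (trans _ (((N + 1) • y + n • x) + (k * n) • y) _ ?_ ?_)
          · convert h1 using 1
            rw [succ_nsmul]; abel
          · convert refl _ using 1
            rw [succ_nsmul]; abel
          · convert h2 using 1
            rw [add_mul, add_nsmul, one_mul]; abel
      have h1 := iter ((N + 2) * (m + 1))
      have h2 := nsmul_rel add zero hm (N + 2)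
      rw [← mul_nsmul'] at h2
      have h3 := add _ _ _ _ h2 (refl (((N + 2) * (m + 1) * n) • x))
      have h4 := add _ _ _ _ (zero (N • y))
        (refl (((N + 2) * (m + 1)) • (y + n • x)))
      rw [zero_add] at h4
      have h5 : r ((N + 2 + (N + 2) * (m + 1) * n) • x) ((N + (N + 2) * (m + 1) * n) • y) := by
        rw [add_nsmul _ (N + 2), add_nsmul y]
        refine trans _ _ _ h3 (trans _ _ _ ?_ (trans _ _ _ h4 h1))
        convert refl _ using 1
        rw [smul_add, mul_nsmul' x ((N + 2) * (m + 1)) n]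
      have h6 : r ((N + 1 + (N + 2) * (m + 1) * n + 1) • x)
          ((N + 1 + (N + 2) * (m + 1) * n) • y) := by
        rw [show N + 1 + (N + 2) * (m + 1) * n + 1 = N + 2 + (N + 2) * (m + 1) * n by ring]
        exact trans _ _ _ h5 (nsmul_rel_of_le refl add zero y (by omega))
      exact hxy _ (by omega) h6)
  refine ⟨D, fun a b h => hD _ _ (hr _ _ h), hDy, ?_⟩
  rw [← hDy]
  exact hD _ _ ⟨1, by convert refl _ using 1; rw [one_smul, one_smul, add_comm]⟩

end States

section Subequivalence

/-- Dynamical subequivalence of finite families, with the pieces indexed by one finite type. -/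
def FamSubeq (G : Type*) [Group G] [MulAction G X] {ι κ : Type*} (A : ι → Set X) (B : κ → Set X) :
    Prop :=
  ∀ F : ι → Set X, (∀ i, IsClosed (F i) ∧ F i ⊆ A i) →
    ∃ (T : Type) (_ : Finite T) (i : T → ι) (U : T → Set X) (s : T → G) (k : T → κ),
      (∀ p, IsOpen (U p)) ∧ (∀ i₀, ∀ x ∈ F i₀, ∃ p, i p = i₀ ∧ x ∈ U p) ∧
      (∀ p, s p • U p ⊆ B (k p)) ∧
      ∀ p q, p ≠ q → k p = k q → Disjoint (s p • U p) (s q • U q)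

theorem setSubeq_iff_famSubeq {A B : List (Set X)} :
    SetSubeq G A B ↔ FamSubeq G A.get B.get := by
  refine forall₂_congr fun F hF => ⟨?_, ?_⟩
  · rintro ⟨J, U, s, k, hU, hF, hs, hd⟩
    refine ⟨Σ i, Fin (J i), inferInstance, Sigma.fst, fun p => U p.1 p.2, fun p => s p.1 p.2,
      fun p => k p.1 p.2, fun p => hU _ _, fun i₀ x hx => ?_, fun p => hs _ _, hd⟩
    obtain ⟨j, hj⟩ := Set.mem_iUnion.1 (hF i₀ hx)
    exact ⟨⟨i₀, j⟩, rfl, hj⟩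
  · rintro ⟨T, _, i, U, s, k, hU, hF, hs, hd⟩
    let e : ∀ i₀, Fin (Nat.card {p // i p = i₀}) ≃ {p // i p = i₀} :=
      fun i₀ => (Finite.equivFin _).symm
    refine ⟨fun i₀ => Nat.card {p // i p = i₀}, fun i₀ j => U (e i₀ j), fun i₀ j => s (e i₀ j),
      fun i₀ j => k (e i₀ j), fun _ _ => hU _, fun i₀ x hx => ?_, fun _ _ => hs _, ?_⟩
    · obtain ⟨p, hp, hx⟩ := hF i₀ x hx
      refine Set.mem_iUnion.2 ⟨(e i₀).symm ⟨p, hp⟩, ?_⟩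
      simpa using hx
    · rintro ⟨i₁, j₁⟩ ⟨i₂, j₂⟩ hne hk
      refine hd _ _ (fun heq => hne ?_) hk
      obtain rfl : i₁ = i₂ := by
        rw [← (e i₁ j₁).2, ← (e i₂ j₂).2]; exact congrArg i heq
      have : j₁ = j₂ := (e i₁).injective (Subtype.ext heq)
      rw [this]

namespace FamSubeq

variable {ι κ ι' κ' : Type*} {A : ι → Set X} {B : κ → Set X}

/-- Pieces covering the whole of `A` witness subequivalence. -/
theorem of_pieces {T : Type} [Finite T] (i : T → ι) (U : T → Set X) (s : T → G) (k : T → κ)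
    (hU : ∀ p, IsOpen (U p)) (hA : ∀ i₀, ∀ x ∈ A i₀, ∃ p, i p = i₀ ∧ x ∈ U p)
    (hs : ∀ p, s p • U p ⊆ B (k p))
    (hd : ∀ p q, p ≠ q → k p = k q → Disjoint (s p • U p) (s q • U q)) : FamSubeq G A B :=
  fun _ hF => ⟨T, inferInstance, i, U, s, k, hU, fun i₀ x hx => hA i₀ x ((hF i₀).2 hx), hs, hd⟩

theorem reindex (h : FamSubeq G A B) (e : ι' ≃ ι) (e' : κ' ≃ κ) :
    FamSubeq G (A ∘ e) (B ∘ e') := by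
  intro F hF
  obtain ⟨T, hT, i, U, s, k, hU, hA, hs, hd⟩ := h (F ∘ e.symm) fun i => by
    simpa using hF (e.symm i)
  refine ⟨T, hT, e.symm ∘ i, U, s, e'.symm ∘ k, hU, fun i₀ x hx => ?_, fun p => ?_,
    fun p q hpq hk => hd p q hpq (e'.symm.injective hk)⟩
  · obtain ⟨p, hp, hx⟩ := hA (e i₀) x (by simpa using hx)
    exact ⟨p, by simp [hp], hx⟩
  · simpa using hs p

theorem sum {A' : ι' → Set X} {B' : κ' → Set X} (h : FamSubeq G A B) (h' : FamSubeq G A' B') :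
    FamSubeq G (Sum.elim A A') (Sum.elim B B') := by
  intro F hF
  obtain ⟨T, hT, i, U, s, k, hU, hA, hs, hd⟩ := h (F ∘ Sum.inl) fun i => hF (Sum.inl i)
  obtain ⟨T', hT', i', U', s', k', hU', hA', hs', hd'⟩ := h' (F ∘ Sum.inr) fun i => hF (Sum.inr i)
  refine ⟨T ⊕ T', inferInstance, Sum.map i i', Sum.elim U U', Sum.elim s s', Sum.map k k',
    ?_, ?_, ?_, ?_⟩
  · rintro (p | p)
    exacts [hU p, hU' p]
  · rintro (i₀ | i₀) x hx
    · obtain ⟨p, hp, hx⟩ := hA i₀ x hx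
      exact ⟨Sum.inl p, by simp [hp], hx⟩
    · obtain ⟨p, hp, hx⟩ := hA' i₀ x hx
      exact ⟨Sum.inr p, by simp [hp], hx⟩
  · rintro (p | p)
    exacts [hs p, hs' p]
  · rintro (p | p) (q | q) hne hk
    · exact hd p q (fun h => hne (h ▸ rfl)) (Sum.inl_injective hk)
    · exact absurd hk Sum.inl_ne_inr
    · exact absurd hk Sum.inr_ne_inl
    · exact hd' p q (fun h => hne (h ▸ rfl)) (Sum.inr_injective hk)

theorem trans [CompactSpace X] [T2Space X] [ContinuousConstSMul G X] {μ : Type*} {C : μ → Set X}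
    (h : FamSubeq G A B) (h' : FamSubeq G B C) : FamSubeq G A C := by
  classical
  intro F hF
  obtain ⟨T, hT, i, U, s, k, hU, hA, hs, hd⟩ := h F hF
  have := Fintype.ofFinite T
  have hcov : ∀ i₀, ∃ K : T → Set X, (∀ p, IsCompact (K p)) ∧ (∀ p, K p ⊆ U p) ∧
      F i₀ = ⋃ p ∈ Finset.univ.filter (fun p => i p = i₀), K p := by
    intro i₀
    refine (hF i₀).1.isCompact.finite_compact_cover _ U (fun p _ => hU p) fun x hx => ?_
    obtain ⟨p, hp, hx⟩ := hA i₀ x hx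
    simp only [Set.mem_iUnion]
    exact ⟨p, by simpa using hp, hx⟩
  choose K hKc hKU hFK using hcov
  obtain ⟨T', hT', i', V, t, c, hV, hB, ht, hd'⟩ :=
    h' (fun k₀ => ⋃ p ∈ {p | k p = k₀}, s p • K (i p) p) fun k₀ => by
      refine ⟨(Set.toFinite _).isClosed_biUnion fun p _ => ((hKc _ p).smul (s p)).isClosed, ?_⟩
      refine Set.iUnion₂_subset fun p hp => ?_
      exact (Set.smul_set_mono (hKU _ p)).trans ((hs p).trans (by rw [hp]))
  have hsub : ∀ (p : T) (q : T'),
      (t q * s p) • (U p ∩ (s p)⁻¹ • V q) ⊆ (t q • s p • U p) ∩ t q • V q := by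
    intro p q
    rw [mul_smul, Set.smul_set_inter, Set.smul_set_inter, smul_inv_smul]
  refine ⟨{pq : T × T' // k pq.1 = i' pq.2}, inferInstance, fun p => i p.1.1,
    fun p => U p.1.1 ∩ (s p.1.1)⁻¹ • V p.1.2, fun p => t p.1.2 * s p.1.1, fun p => c p.1.2,
    fun p => (hU _).inter ((hV _).smul _), fun i₀ x hx => ?_,
    fun p => (hsub _ _).trans (Set.inter_subset_right.trans (ht _)), ?_⟩
  · rw [hFK i₀] at hx
    simp only [Set.mem_iUnion, Finset.mem_filter, Finset.mem_univ, true_and] at hx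
    obtain ⟨p, hp, hx⟩ := hx
    obtain ⟨q, hq, hxq⟩ := hB (k p) (s p • x) (by
      simp only [Set.mem_iUnion]
      exact ⟨p, rfl, Set.smul_mem_smul_set (by rwa [hp])⟩)
    exact ⟨⟨(p, q), hq.symm⟩, hp, hKU _ _ hx, Set.mem_inv_smul_set_iff.2 hxq⟩
  · rintro ⟨⟨p, q⟩, hpq⟩ ⟨⟨p', q'⟩, hpq'⟩ hne hc
    refine Set.disjoint_of_subset (hsub p q) (hsub p' q') ?_
    by_cases hqq : q = q'
    · subst hqq
      have hpp : p ≠ p' := fun h => hne (by subst h; rfl)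
      refine Set.disjoint_of_subset Set.inter_subset_left Set.inter_subset_left ?_
      exact Set.disjoint_smul_set.2 (hd p p' hpp (hpq.trans hpq'.symm))
    · exact Set.disjoint_of_subset Set.inter_subset_right Set.inter_subset_right
        (hd' q q' hqq hc)

end FamSubeq

theorem SetSubeq.trans [CompactSpace X] [T2Space X] [ContinuousConstSMul G X]
    {A B C : List (Set X)} (h : SetSubeq G A B) (h' : SetSubeq G B C) : SetSubeq G A C :=
  setSubeq_iff_famSubeq.2 ((setSubeq_iff_famSubeq.1 h).trans (setSubeq_iff_famSubeq.1 h'))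

/-- The index type of a concatenation. -/
def appendEquiv {α : Type*} (A B : List α) :
    Fin (A ++ B).length ≃ Fin A.length ⊕ Fin B.length :=
  (finCongr List.length_append).trans finSumFinEquiv.symm

theorem get_append_eq {α : Type*} (A B : List α) :
    (A ++ B).get = Sum.elim A.get B.get ∘ appendEquiv A B := by
  rw [← Equiv.comp_symm_eq]
  funext i
  rcases i with i | i <;> simp [appendEquiv]

theorem SetSubeq.append {A B A' B' : List (Set X)} (h : SetSubeq G A B)
    (h' : SetSubeq G A' B') : SetSubeq G (A ++ A') (B ++ B') := by
  rw [setSubeq_iff_famSubeq] at h h' ⊢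
  rw [get_append_eq, get_append_eq]
  exact (h.sum h').reindex _ _

theorem SetSubeq.refl {A : List (Set X)} (hA : ∀ s ∈ A, IsOpen s) : SetSubeq G A A := by
  rw [setSubeq_iff_famSubeq]
  refine FamSubeq.of_pieces (T := Fin A.length) id A.get (fun _ => 1) id
    (fun p => hA _ (List.get_mem _ _)) (fun i x hx => ⟨i, rfl, hx⟩) (fun p => by simp)
    (fun p q hpq h => absurd h hpq)

theorem SetSubeq.nil (A : List (Set X)) : SetSubeq G [] A := by
  rw [setSubeq_iff_famSubeq]
  exact FamSubeq.of_pieces (T := Empty) Empty.elim Empty.elim Empty.elim Empty.elim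
    (fun p => p.elim) (fun i => i.elim0) (fun p => p.elim) (fun p => p.elim)

theorem SetSubeq.of_perm [CompactSpace X] [T2Space X] [ContinuousConstSMul G X]
    {A B : List (Set X)} (h : A.Perm B) (hA : ∀ s ∈ A, IsOpen s) : SetSubeq G A B := by
  induction h with
  | nil => exact SetSubeq.nil _
  | cons x _ ih =>
    exact SetSubeq.append (A := [x]) (B := [x])
      (SetSubeq.refl fun s hs => hA s (by simp_all)) (ih fun s hs => hA s (by simp [hs]))
  | swap x y l =>
    refine SetSubeq.append (A := [y, x]) (B := [x, y]) ?_
      (SetSubeq.refl fun s hs => hA s (by simp [hs]))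
    rw [setSubeq_iff_famSubeq]
    refine FamSubeq.of_pieces (T := Fin 2) id [y, x].get (fun _ => 1) ![1, 0] ?_
      (fun i x hx => ⟨i, rfl, hx⟩) ?_ ?_
    · intro p
      exact hA _ (by fin_cases p <;> simp)
    · intro p
      fin_cases p <;> simp
    · intro p q hpq h
      fin_cases p <;> fin_cases q <;> simp_all
  | trans h₁ _ ih₁ ih₂ => exact (ih₁ hA).trans (ih₂ fun s hs => hA s (h₁.mem_iff.2 hs))

/-- Dynamical subequivalence of multisets of sets. -/
def MSubeq (G : Type*) [Group G] [MulAction G X] (u v : Multiset (Set X)) : Prop :=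
  SetSubeq G u.toList v.toList

namespace MSubeq

theorem refl {u : Multiset (Set X)} (hu : ∀ s ∈ u, IsOpen s) : MSubeq G u u :=
  SetSubeq.refl (by simpa using hu)

theorem zero (u : Multiset (Set X)) : MSubeq G 0 u := by
  unfold MSubeq
  rw [Multiset.toList_zero]
  exact SetSubeq.nil _

variable [CompactSpace X] [T2Space X] [ContinuousConstSMul G X]

theorem trans {u v w : Multiset (Set X)} (h : MSubeq G u v) (h' : MSubeq G v w) : MSubeq G u w :=
  SetSubeq.trans h h'

theorem coe_iff {A B : List (Set X)} (hA : ∀ s ∈ A, IsOpen s) (hB : ∀ s ∈ B, IsOpen s) :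
    MSubeq G (A : Multiset (Set X)) B ↔ SetSubeq G A B := by
  have hpA := Multiset.coe_eq_coe.1 (Multiset.coe_toList (A : Multiset (Set X)))
  have hpB := Multiset.coe_eq_coe.1 (Multiset.coe_toList (B : Multiset (Set X)))
  constructor
  · intro h
    exact ((SetSubeq.of_perm hpA.symm hA).trans h).trans
      (SetSubeq.of_perm hpB (by simpa using hB))
  · intro h
    exact ((SetSubeq.of_perm hpA (by simpa using hA)).trans h).trans
      (SetSubeq.of_perm hpB.symm hB)

theorem add {u v u' v' : Multiset (Set X)} (hu : ∀ s ∈ u, IsOpen s) (hv : ∀ s ∈ v, IsOpen s)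
    (hu' : ∀ s ∈ u', IsOpen s) (hv' : ∀ s ∈ v', IsOpen s)
    (h : MSubeq G u v) (h' : MSubeq G u' v') : MSubeq G (u + u') (v + v') := by
  induction u, v using Quotient.inductionOn₂ with | _ A B
  induction u', v' using Quotient.inductionOn₂ with | _ A' B'
  simp only [Multiset.quot_mk_to_coe, Multiset.mem_coe] at *
  rw [coe_iff hu hv] at h
  rw [coe_iff hu' hv'] at h'
  rw [Multiset.coe_add, Multiset.coe_add, coe_iff]
  · exact h.append h'
  · intro s hs
    exact (List.mem_append.1 hs).elim (hu s) (hu' s)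
  · intro s hs
    exact (List.mem_append.1 hs).elim (hv s) (hv' s)

theorem singleton_iff {O O' : Set X} (hO : IsOpen O) (hO' : IsOpen O') :
    MSubeq G {O} {O'} ↔ SetSubeq G [O] [O'] :=
  coe_iff (A := [O]) (B := [O']) (by simpa using hO) (by simpa using hO')

theorem of_smul_subset {O O' : Set X} (hO : IsOpen O) (hO' : IsOpen O') (g : G)
    (h : g • O ⊆ O') : MSubeq G {O} {O'} := by
  rw [singleton_iff hO hO', setSubeq_iff_famSubeq]
  exact FamSubeq.of_pieces (T := Fin 1) id (fun _ => O) (fun _ => g) id (fun _ => hO)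
    (fun i x hx => ⟨i, rfl, by simpa using hx⟩) (fun p => by simpa using h)
    (fun p q hpq h => absurd h hpq)

theorem of_subset {O O' : Set X} (hO : IsOpen O) (hO' : IsOpen O') (h : O ⊆ O') :
    MSubeq G {O} {O'} :=
  of_smul_subset hO hO' 1 (by simpa using h)

theorem empty_zero : MSubeq G {(∅ : Set X)} 0 := by
  refine (coe_iff (A := [∅]) (B := []) (by simp) (by simp)).2 ?_
  rw [setSubeq_iff_famSubeq]
  exact FamSubeq.of_pieces (T := Empty) Empty.elim Empty.elim Empty.elim Empty.elim
    (fun p => p.elim) (fun i x hx => by simp at hx) (fun p => p.elim) (fun p => p.elim)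

theorem union_add {O O' : Set X} (hO : IsOpen O) (hO' : IsOpen O') :
    MSubeq G {O ∪ O'} ({O} + {O'}) := by
  refine (coe_iff (A := [O ∪ O']) (B := [O, O']) (by simpa using hO.union hO')
    (by simp [hO, hO'])).2 ?_
  rw [setSubeq_iff_famSubeq]
  refine FamSubeq.of_pieces (T := Fin 2) (fun _ => (0 : Fin 1)) [O, O'].get (fun _ => 1) id
    ?_ ?_ (fun p => by simp) (fun p q hpq h => absurd h hpq)
  · intro p
    fin_cases p
    exacts [hO, hO']
  · intro i x hx
    have hx : x ∈ O ∪ O' := by simpa using hx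
    rcases hx with hx | hx
    · exact ⟨0, Subsingleton.elim (α := Fin 1) _ _, hx⟩
    · exact ⟨1, Subsingleton.elim (α := Fin 1) _ _, hx⟩

theorem add_of_disjoint {O₁ O₂ O : Set X} (h₁ : IsOpen O₁) (h₂ : IsOpen O₂) (hO : IsOpen O)
    (hd : Disjoint O₁ O₂) (hO₁ : O₁ ⊆ O) (hO₂ : O₂ ⊆ O) : MSubeq G ({O₁} + {O₂}) {O} := by
  refine (coe_iff (A := [O₁, O₂]) (B := [O]) (by simp [h₁, h₂]) (by simpa using hO)).2 ?_
  rw [setSubeq_iff_famSubeq]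
  refine FamSubeq.of_pieces (T := Fin 2) id [O₁, O₂].get (fun _ => 1) (fun _ => (0 : Fin 1))
    ?_ (fun i x hx => ⟨i, rfl, hx⟩) ?_ ?_
  · intro p
    fin_cases p
    exacts [h₁, h₂]
  · intro p
    fin_cases p
    · simpa using hO₁
    · simpa using hO₂
  · intro p q hpq _
    fin_cases p <;> fin_cases q
    · exact absurd rfl hpq
    · simpa using hd
    · simpa using hd.symm
    · exact absurd rfl hpq

theorem nsmul_iff {A B : List (Set X)} (hA : ∀ s ∈ A, IsOpen s) (hB : ∀ s ∈ B, IsOpen s)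
    (m n : ℕ) : MSubeq G (m • (A : Multiset (Set X))) (n • (B : Multiset (Set X))) ↔
      SetSubeq G (List.replicate m A).flatten (List.replicate n B).flatten := by
  have key : ∀ (C : List (Set X)) (j : ℕ),
      j • (C : Multiset (Set X)) = ((List.replicate j C).flatten : Multiset (Set X)) := by
    intro C j
    induction j with
    | zero => simp
    | succ j ih =>
      rw [succ_nsmul', ih, List.replicate_succ, List.flatten_cons, Multiset.coe_add]
  rw [key, key, coe_iff]
  · intro s hs
    obtain ⟨l, hl, hs⟩ := List.mem_flatten.1 hs
    exact hA s (by rwa [← (List.mem_replicate.1 hl).2])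
  · intro s hs
    obtain ⟨l, hl, hs⟩ := List.mem_flatten.1 hs
    exact hB s (by rwa [← (List.mem_replicate.1 hl).2])

end MSubeq

end Subequivalence

section Measure

open MeasureTheory TopologicalSpace

/-- A finite, `G`-invariant, additive set function on a family `P` of open sets which is large
enough to cover the compact subsets of `U`. -/
structure IsOpenContent (G : Type*) [Group G] [MulAction G X] (U : Set X) (P : Set X → Prop)
    (d : Set X → ℝ≥0) : Prop where
  isOpen : ∀ O, P O → IsOpen O
  exists_superset : ∀ K ⊆ U, IsCompact K → ∃ O, P O ∧ K ⊆ O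
  subset : ∀ O O', P O → IsOpen O' → O' ⊆ O → P O'
  union : ∀ O O', P O → P O' → P (O ∪ O')
  mono : ∀ O O', P O → IsOpen O' → O' ⊆ O → d O' ≤ d O
  union_le : ∀ O O', P O → P O' → d (O ∪ O') ≤ d O + d O'
  add_le : ∀ O O₁ O₂, P O → IsOpen O₁ → IsOpen O₂ → O₁ ⊆ O → O₂ ⊆ O → Disjoint O₁ O₂ →
    d O₁ + d O₂ ≤ d O
  smul : ∀ (g : G) O, P O → P (g • O)
  smul_le : ∀ (g : G) O, P O → d (g • O) ≤ d O

namespace IsOpenContent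

variable {U : Set X} {P : Set X → Prop} {d : Set X → ℝ≥0}

/-- The outer approximation of a set function by admissible open sets. -/
noncomputable def outer {Y : Type*} (P : Set Y → Prop) (d : Set Y → ℝ≥0) (K : Set Y) : ℝ≥0 :=
  ⨅ O : {O // P O ∧ K ⊆ O}, d O

theorem outer_le {Y : Type*} {P : Set Y → Prop} {d : Set Y → ℝ≥0} {K O : Set Y} (hO : P O)
    (hK : K ⊆ O) : outer P d K ≤ d O :=
  ciInf_le (OrderBot.bddBelow _) (⟨O, hO, hK⟩ : {O // P O ∧ K ⊆ O})

theorem le_outer (h : IsOpenContent G U P d) {K : Set X} (hKU : K ⊆ U) (hK : IsCompact K) {c : ℝ≥0}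
    (hc : ∀ O, P O → K ⊆ O → c ≤ d O) : c ≤ outer P d K := by
  obtain ⟨O, hO, hKO⟩ := h.exists_superset K hKU hK
  have : Nonempty {O // P O ∧ K ⊆ O} := ⟨⟨O, hO, hKO⟩⟩
  exact le_ciInf fun O => hc O O.2.1 O.2.2

theorem exists_lt (h : IsOpenContent G U P d) {K : Set X} (hKU : K ⊆ U) (hK : IsCompact K)
    {ε : ℝ≥0} (hε : 0 < ε) : ∃ O, P O ∧ K ⊆ O ∧ d O < outer P d K + ε := by
  obtain ⟨O, hO, hKO⟩ := h.exists_superset K hKU hK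
  have : Nonempty {O // P O ∧ K ⊆ O} := ⟨⟨O, hO, hKO⟩⟩
  obtain ⟨O, hO⟩ := exists_lt_of_ciInf_lt (lt_add_of_pos_right (outer P d K) hε)
  exact ⟨O, O.2.1, O.2.2, hO⟩

theorem outer_mono (h : IsOpenContent G U P d) {K K' : Set X} (hKU : K' ⊆ U) (hK' : IsCompact K')
    (hKK : K ⊆ K') : outer P d K ≤ outer P d K' :=
  h.le_outer hKU hK' fun _ hO hK => outer_le hO (hKK.trans hK)

theorem outer_union_le (h : IsOpenContent G U P d) {K K' : Set X} (hKU : K ⊆ U) (hK : IsCompact K)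
    (hKU' : K' ⊆ U) (hK' : IsCompact K') :
    outer P d (K ∪ K') ≤ outer P d K + outer P d K' := by
  refine le_of_forall_pos_le_add fun ε hε => ?_
  obtain ⟨O, hO, hKO, hd⟩ := h.exists_lt hKU hK (half_pos hε)
  obtain ⟨O', hO', hKO', hd'⟩ := h.exists_lt hKU' hK' (half_pos hε)
  calc outer P d (K ∪ K') ≤ d (O ∪ O') :=
        outer_le (h.union _ _ hO hO') (Set.union_subset_union hKO hKO')
    _ ≤ d O + d O' := h.union_le _ _ hO hO'
    _ ≤ (outer P d K + ε / 2) + (outer P d K' + ε / 2) := add_le_add hd.le hd'.le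
    _ = outer P d K + outer P d K' + ε := by
        rw [add_add_add_comm, add_halves]

theorem outer_union [T2Space X] (h : IsOpenContent G U P d) {K K' : Set X} (hKU : K ⊆ U)
    (hK : IsCompact K) (hKU' : K' ⊆ U) (hK' : IsCompact K') (hdis : Disjoint K K') :
    outer P d (K ∪ K') = outer P d K + outer P d K' := by
  refine le_antisymm (h.outer_union_le hKU hK hKU' hK') ?_
  refine h.le_outer (Set.union_subset hKU hKU') (hK.union hK') fun O hO hKO => ?_
  obtain ⟨V, V', hV, hV', hKV, hKV', hVV⟩ := SeparatedNhds.of_isCompact_isCompact hK hK' hdis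
  have hOo := h.isOpen O hO
  refine le_trans (add_le_add (outer_le (h.subset _ _ hO (hOo.inter hV) Set.inter_subset_left) ?_)
    (outer_le (h.subset _ _ hO (hOo.inter hV') Set.inter_subset_left) ?_))
    (h.add_le O (O ∩ V) (O ∩ V') hO (hOo.inter hV) (hOo.inter hV') Set.inter_subset_left
      Set.inter_subset_left (hVV.mono Set.inter_subset_right Set.inter_subset_right))
  · exact Set.subset_inter (Set.subset_union_left.trans hKO) hKV
  · exact Set.subset_inter (Set.subset_union_right.trans hKO) hKV'

theorem outer_smul_le [ContinuousConstSMul G X] (h : IsOpenContent G U P d)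
    {K : Set X} (hKU : K ⊆ U) (hK : IsCompact K) (g : G) :
    outer P d (g • K) ≤ outer P d K :=
  h.le_outer hKU hK fun O hO hKO =>
    (outer_le (h.smul g O hO) (Set.smul_set_mono hKO)).trans (h.smul_le g O hO)

/-- The content on compact subsets of `U` defined by outer approximation. -/
noncomputable def content [T2Space X] (h : IsOpenContent G U P d) : Content U where
  toFun K := outer P d (Subtype.val '' (K : Set U))
  mono' K K' hK := h.outer_mono (by simp) (K'.isCompact.image continuous_subtype_val)
    (Set.image_mono hK)
  sup_disjoint' K K' hd _ _ := by
    rw [Compacts.coe_sup, Set.image_union]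
    exact h.outer_union (by simp) (K.isCompact.image continuous_subtype_val) (by simp)
      (K'.isCompact.image continuous_subtype_val)
      (Set.disjoint_image_of_injective Subtype.val_injective hd)
  sup_le' K K' := by
    rw [Compacts.coe_sup, Set.image_union]
    exact h.outer_union_le (by simp) (K.isCompact.image continuous_subtype_val) (by simp)
      (K'.isCompact.image continuous_subtype_val)

theorem content_apply [T2Space X] (h : IsOpenContent G U P d) (K : Compacts U) :
    h.content K = outer P d (Subtype.val '' (K : Set U)) := rfl

end IsOpenContent

/-- The homeomorphism of an invariant set induced by a group element. -/
def invariantHomeomorph [ContinuousConstSMul G X] {U : Set X} (hU : ∀ g : G, g • U ⊆ U) (g : G) :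
    U ≃ₜ U where
  toFun x := ⟨g • x.1, hU g (Set.smul_mem_smul_set x.2)⟩
  invFun x := ⟨g⁻¹ • x.1, hU g⁻¹ (Set.smul_mem_smul_set x.2)⟩
  left_inv x := by simp
  right_inv x := by simp
  continuous_toFun := (continuous_subtype_val.const_smul g).subtype_mk _
  continuous_invFun := (continuous_subtype_val.const_smul g⁻¹).subtype_mk _

theorem IsOpenContent.exists_measure [CompactSpace X] [T2Space X] [ContinuousConstSMul G X]
    [MeasurableSpace X] [BorelSpace X] {U : Set X} {P : Set X → Prop} {d : Set X → ℝ≥0}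
    (h : IsOpenContent G U P d) (hUo : IsOpen U) (hU : ∀ g : G, g • U ⊆ U) :
    ∃ ν : Measure U, ν.Regular ∧
      (∀ (g : G) (s : Set X), MeasurableSet s →
        ν (Subtype.val ⁻¹' (g • s)) = ν (Subtype.val ⁻¹' s)) ∧
      (∀ O, P O → ν (Subtype.val ⁻¹' O) ≤ d O) ∧
      ∀ O K, P O → IsCompact K → O ⊆ K → K ⊆ U → d O ≤ ν (Subtype.val ⁻¹' K) := by
  have : LocallyCompactSpace U := hUo.locallyCompactSpace
  refine ⟨h.content.measure, inferInstance, fun g s hs => ?_, fun O hO => ?_,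
    fun O K hO hK hOK hKU => ?_⟩
  · have hs' : MeasurableSet (Subtype.val ⁻¹' s : Set U) := measurable_subtype_coe hs
    let φ := invariantHomeomorph hU g⁻¹
    have e : (Subtype.val ⁻¹' (g • s) : Set U) = φ ⁻¹' (Subtype.val ⁻¹' s) := by
      ext x
      exact Set.mem_smul_set_iff_inv_smul_mem
    rw [e, Content.measure_apply _ (φ.continuous.measurable hs'), Content.measure_apply _ hs']
    refine Content.outerMeasure_preimage _ φ (fun K => ?_) _
    have hK : IsCompact (Subtype.val '' (K : Set U)) := K.isCompact.image continuous_subtype_val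
    have hKU : Subtype.val '' (K : Set U) ⊆ U := by simp
    have e' : Subtype.val '' (K.map φ φ.continuous : Set U) =
        g⁻¹ • (Subtype.val '' (K : Set U)) := by
      rw [Compacts.coe_map, Set.image_image, ← Set.image_smul, Set.image_image]
      rfl
    rw [h.content_apply, h.content_apply, e']
    congr 1
    refine le_antisymm (h.outer_smul_le hKU hK _) ?_
    have := h.outer_smul_le ((Set.smul_set_mono hKU).trans (hU g⁻¹)) (hK.smul g⁻¹) g
    rwa [smul_inv_smul] at this
  · have hO' : IsOpen (Subtype.val ⁻¹' O : Set U) :=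
      (h.isOpen O hO).preimage continuous_subtype_val
    rw [Content.measure_apply _ hO'.measurableSet, Content.outerMeasure_of_isOpen _ _ hO']
    refine iSup₂_le fun K hK => ?_
    rw [h.content_apply]
    exact ENNReal.coe_le_coe.2 (outer_le hO (Set.image_subset_iff.2 hK))
  · have hKc : IsCompact (Subtype.val ⁻¹' K : Set U) := by
      rw [Topology.IsInducing.subtypeVal.isCompact_iff, Subtype.image_preimage_coe,
        Set.inter_eq_self_of_subset_right hKU]
      exact hK
    have hm : MeasurableSet (Subtype.val ⁻¹' K : Set U) :=
      measurable_subtype_coe hK.isClosed.measurableSet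
    rw [Content.measure_apply _ hm]
    refine le_trans ?_ (Content.le_outerMeasure_compacts h.content ⟨_, hKc⟩)
    rw [h.content_apply]
    refine ENNReal.coe_le_coe.2 ?_
    have e : Subtype.val '' (Subtype.val ⁻¹' K : Set U) = K := by
      rw [Subtype.image_preimage_coe, Set.inter_eq_self_of_subset_right hKU]
    change d O ≤ outer P d (Subtype.val '' (Subtype.val ⁻¹' K : Set U))
    rw [e]
    exact h.le_outer hKU hK fun O' hO' hKO' => h.mono _ _ hO' (h.isOpen O hO) (hOK.trans hKO')

theorem InAlg.measurableSet [MeasurableSpace X] [BorelSpace X] {s : Set X} (hs : InAlg X s) :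
    MeasurableSet s := by
  unfold InAlg at hs
  induction hs with
  | base s h => exact IsOpen.measurableSet h
  | empty => exact MeasurableSet.empty
  | compl s _ ih => exact ih.compl
  | union s t _ _ ih₁ ih₂ => exact ih₁.union ih₂

theorem InAlg.smul [ContinuousConstSMul G X] {s : Set X} (hs : InAlg X s) (g : G) :
    InAlg X (g • s) := by
  unfold InAlg at hs
  induction hs with
  | base s h => exact .base _ (IsOpen.smul h g)
  | empty => rw [Set.smul_set_empty]; exact .empty
  | compl s _ ih => rw [Set.smul_set_compl]; exact .compl _ ih
  | union s t _ _ ih₁ ih₂ => rw [Set.smul_set_union]; exact .union _ _ ih₁ ih₂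

theorem IsOpen.inAlg {s : Set X} (hs : IsOpen s) : InAlg X s := .base _ hs

theorem IsClosed.inAlg {s : Set X} (hs : IsClosed s) : InAlg X s := by
  rw [← compl_compl s]
  exact .compl _ (.base _ hs.isOpen_compl)

/-- Extending a regular invariant measure on an invariant open set by `∞` outside of it gives an
invariant regular premeasure. -/
theorem exists_premeasure [T2Space X] [SecondCountableTopology X] [CompactSpace X]
    [ContinuousConstSMul G X] [MeasurableSpace X] [BorelSpace X] {U : Set X} (hUo : IsOpen U)
    (hU : ∀ g : G, g • U ⊆ U) (ν : Measure U) [ν.Regular]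
    (hν : ∀ (g : G) (s : Set X), MeasurableSet s →
      ν (Subtype.val ⁻¹' (g • s)) = ν (Subtype.val ⁻¹' s)) :
    ∃ μ : InvRegPremeasure X G, ∀ s, InAlg X s → s ⊆ U → μ.m s = ν (Subtype.val ⁻¹' s) := by
  classical
  have : LocallyCompactSpace U := hUo.locallyCompactSpace
  let m : Set X → ℝ≥0∞ := fun s =>
    if InAlg X s then if s ⊆ U then ν (Subtype.val ⁻¹' s) else ∞ else 0
  have m_sub : ∀ s, InAlg X s → s ⊆ U → m s = ν (Subtype.val ⁻¹' s) := fun s h h' => by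
    simp only [m, if_pos h, if_pos h']
  have m_top : ∀ s, InAlg X s → ¬ s ⊆ U → m s = ∞ := fun s h h' => by
    simp only [m, if_pos h, if_neg h']
  have m_mono : ∀ s t, InAlg X s → InAlg X t → s ⊆ t → m s ≤ m t := by
    intro s t hs ht hst
    by_cases h : t ⊆ U
    · rw [m_sub s hs (hst.trans h), m_sub t ht h]
      exact measure_mono (Set.preimage_mono hst)
    · rw [m_top t ht h]
      exact le_top
  refine ⟨⟨m, fun s hs => if_neg hs, ?_, ?_, ?_, ?_, ?_⟩, m_sub⟩
  · rw [m_sub ∅ isOpen_empty.inAlg (Set.empty_subset _)]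
    simp
  · intro A hA hd hAU
    by_cases h : (⋃ n, A n) ⊆ U
    · rw [m_sub _ hAU h, Set.preimage_iUnion, measure_iUnion]
      · exact tsum_congr fun n => (m_sub _ (hA n) ((Set.subset_iUnion A n).trans h)).symm
      · exact fun i j hij => (hd hij).preimage _
      · exact fun n => measurable_subtype_coe (hA n).measurableSet
    · rw [m_top _ hAU h]
      obtain ⟨n, hn⟩ : ∃ n, ¬ A n ⊆ U := by simpa using h
      exact (ENNReal.tsum_eq_top_of_eq_top ⟨n, m_top _ (hA n) hn⟩).symm
  · intro g s hs
    have key : ∀ (g : G) (s : Set X), s ⊆ U → g • s ⊆ U :=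
      fun g s h => (Set.smul_set_mono h).trans (hU g)
    by_cases h : s ⊆ U
    · rw [m_sub s hs h, m_sub _ (hs.smul g) (key g s h), hν g s hs.measurableSet]
    · rw [m_top s hs h, m_top _ (hs.smul g)]
      intro h'
      have := key g⁻¹ _ h'
      rw [inv_smul_smul] at this
      exact h this
  · intro s hs
    refine le_antisymm ?_ (iSup₂_le fun F hF => m_mono _ _ hF.1.isClosed.inAlg hs hF.2)
    by_cases h : s ⊆ U
    · rw [m_sub s hs h,
        (measurable_subtype_coe hs.measurableSet).measure_eq_iSup_isCompact ν]
      refine iSup_le fun K => iSup₂_le fun hKs hK => ?_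
      have hK' : IsCompact (Subtype.val '' K) := hK.image continuous_subtype_val
      refine le_trans ?_ (le_iSup₂ (f := fun F (_ : IsCompact F ∧ F ⊆ s) => m F)
        (Subtype.val '' K) ⟨hK', Set.image_subset_iff.2 hKs⟩)
      rw [m_sub _ hK'.isClosed.inAlg (by simp),
        Set.preimage_image_eq _ Subtype.val_injective]
    · obtain ⟨x, hx, hxU⟩ := Set.not_subset.1 h
      refine le_trans ?_ (le_iSup₂ (f := fun F (_ : IsCompact F ∧ F ⊆ s) => m F)
        {x} ⟨isCompact_singleton, by simpa using hx⟩)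
      rw [m_top {x} isClosed_singleton.inAlg (by simpa using hxU)]
      exact le_top
  · intro s hs
    refine le_antisymm (le_iInf₂ fun O hO => m_mono _ _ hs hO.1.inAlg hO.2) ?_
    by_cases h : s ⊆ U
    · rw [m_sub s hs h, Set.measure_eq_iInf_isOpen]
      refine le_iInf fun O => le_iInf₂ fun hsO hO => ?_
      have hO' : IsOpen (Subtype.val '' O) := hUo.isOpenMap_subtype_val _ hO
      refine (iInf₂_le (f := fun O (_ : IsOpen O ∧ s ⊆ O) => m O) (Subtype.val '' O)
        ⟨hO', fun x hx => ⟨⟨x, h hx⟩, hsO hx, rfl⟩⟩).trans ?_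
      rw [m_sub _ hO'.inAlg (by simp), Set.preimage_image_eq _ Subtype.val_injective]
    · rw [m_top s hs h]
      exact le_top

end Measure

section Premeasure

open MeasureTheory

namespace InvRegPremeasure

/-- The finitely additive content underlying a premeasure. -/
noncomputable def addContent (μ : InvRegPremeasure X G) :
    AddContent ℝ≥0∞ (generateSetAlgebra {t : Set X | IsOpen t}) :=
  isSetAlgebra_generateSetAlgebra.isSetRing.addContent_of_union μ.m μ.empty' (by
    intro s t hs ht hst
    have hst' : InAlg X (s ∪ t) := .union s t hs ht
    let A : ℕ → Set X := fun n => if n = 0 then s else if n = 1 then t else ∅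
    have hA : (⋃ n, A n) = s ∪ t := by
      apply subset_antisymm
      · refine Set.iUnion_subset fun n => ?_
        simp only [A]
        split_ifs <;> simp
      · exact Set.union_subset (Set.subset_iUnion A 0) (Set.subset_iUnion A 1)
    have h := μ.countably_additive A (fun n => by
        simp only [A]
        split_ifs
        exacts [hs, ht, .empty]) (fun i j hij => by
        simp only [Function.onFun, A]
        split_ifs <;> simp_all [disjoint_comm]) (by rwa [hA])
    rw [hA, tsum_eq_sum (s := {0, 1}) (fun n hn => by
      simp only [Finset.mem_insert, Finset.mem_singleton, not_or] at hn
      simp [A, hn.1, hn.2, μ.empty'])] at h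
    simpa [A] using h)

theorem m_mono (μ : InvRegPremeasure X G) {s t : Set X} (hs : InAlg X s) (ht : InAlg X t)
    (h : s ⊆ t) : μ.m s ≤ μ.m t :=
  addContent_mono (m := μ.addContent) isSetAlgebra_generateSetAlgebra.isSetRing.isSetSemiring
    hs ht h

theorem m_biUnion_le (μ : InvRegPremeasure X G) {ι : Type*} (S : Finset ι) {A : ι → Set X}
    (hA : ∀ i ∈ S, InAlg X (A i)) : μ.m (⋃ i ∈ S, A i) ≤ ∑ i ∈ S, μ.m (A i) :=
  addContent_biUnion_le (m := μ.addContent) isSetAlgebra_generateSetAlgebra.isSetRing hA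

theorem sum_m_le (μ : InvRegPremeasure X G) {ι : Type*} (S : Finset ι) {A : ι → Set X} {B : Set X}
    (hA : ∀ i ∈ S, InAlg X (A i)) (hB : InAlg X B) (hd : (S : Set ι).PairwiseDisjoint A)
    (hAB : ∀ i ∈ S, A i ⊆ B) : ∑ i ∈ S, μ.m (A i) ≤ μ.m B := by
  have hU : InAlg X (⋃ i ∈ S, A i) := isSetAlgebra_generateSetAlgebra.biUnion_mem S hA
  rw [← show μ.m (⋃ i ∈ S, A i) = ∑ i ∈ S, μ.m (A i) from
    addContent_biUnion (m := μ.addContent) hA hd hU]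
  exact μ.m_mono hU hB (Set.iUnion₂_subset hAB)

theorem sum_le_of_famSubeq [CompactSpace X] [T2Space X] [ContinuousConstSMul G X]
    (μ : InvRegPremeasure X G) {ι κ : Type*} [Fintype ι] [Fintype κ] {A : ι → Set X}
    {B : κ → Set X} (hA : ∀ i, IsOpen (A i)) (hB : ∀ k, IsOpen (B k)) (h : FamSubeq G A B) :
    ∑ i, μ.m (A i) ≤ ∑ k, μ.m (B k) := by
  classical
  have hsup : ∀ i, μ.m (A i) =
      ⨆ F : {F : ι → Set X // ∀ i, IsClosed (F i) ∧ F i ⊆ A i}, μ.m (F.1 i) := by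
    intro i
    rw [μ.inner_regular _ (hA i).inAlg]
    refine le_antisymm (iSup₂_le fun F hF => ?_) (iSup_le fun F => ?_)
    · refine le_trans ?_ (le_iSup (fun F : {F : ι → Set X // ∀ i, IsClosed (F i) ∧ F i ⊆ A i} =>
        μ.m (F.1 i)) ⟨Function.update (fun _ => ∅) i F, fun j => ?_⟩)
      · simp
      · rcases eq_or_ne j i with rfl | hj
        · simpa using ⟨hF.1.isClosed, hF.2⟩
        · simp [hj]
    · exact le_iSup₂ (f := fun K (_ : IsCompact K ∧ K ⊆ A i) => μ.m K) (F.1 i)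
        ⟨(F.2 i).1.isCompact, (F.2 i).2⟩
  simp only [hsup]
  rw [ENNReal.finsetSum_iSup]
  · refine iSup_le fun ⟨F, hF⟩ => ?_
    obtain ⟨T, _, i, U, s, k, hU, hcov, hs, hd⟩ := h F hF
    have := Fintype.ofFinite T
    have hsU : ∀ p, IsOpen (s p • U p) := fun p => (hU p).smul _
    calc ∑ i₀, μ.m (F i₀) ≤ ∑ i₀, ∑ p with i p = i₀, μ.m (U p) := by
          refine Finset.sum_le_sum fun i₀ _ => ?_
          refine le_trans (μ.m_mono (hF i₀).1.inAlg ?_ ?_)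
            (μ.m_biUnion_le _ fun p _ => (hU p).inAlg)
          · exact isSetAlgebra_generateSetAlgebra.biUnion_mem _ fun p _ => (hU p).inAlg
          · intro x hx
            obtain ⟨p, hp, hx⟩ := hcov i₀ x hx
            simp only [Set.mem_iUnion]
            exact ⟨p, by simpa using hp, hx⟩
      _ = ∑ p, μ.m (U p) := Finset.sum_fiberwise _ _ _
      _ = ∑ p, μ.m (s p • U p) :=
          Finset.sum_congr rfl fun p _ => (μ.invariant _ _ (hU p).inAlg).symm
      _ = ∑ k₀, ∑ p with k p = k₀, μ.m (s p • U p) := (Finset.sum_fiberwise _ _ _).symm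
      _ ≤ ∑ k₀, μ.m (B k₀) := by
          refine Finset.sum_le_sum fun k₀ _ => μ.sum_m_le _ (fun p _ => (hsU p).inAlg)
            (hB k₀).inAlg (fun p hp q hq hpq => ?_) fun p hp => ?_
          · simp only [Finset.coe_filter, Finset.mem_univ, true_and, Set.mem_ofPred_eq] at hp hq
            exact hd p q hpq (hp.trans hq.symm)
          · rw [← (Finset.mem_filter.1 hp).2]
            exact hs p
  · intro F F'
    refine ⟨⟨fun i => F.1 i ∪ F'.1 i, fun i => ⟨(F.2 i).1.union (F'.2 i).1,
      Set.union_subset (F.2 i).2 (F'.2 i).2⟩⟩, fun i => ⟨?_, ?_⟩⟩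
    · exact μ.m_mono (F.2 i).1.inAlg ((F.2 i).1.union (F'.2 i).1).inAlg Set.subset_union_left
    · exact μ.m_mono (F'.2 i).1.inAlg ((F.2 i).1.union (F'.2 i).1).inAlg Set.subset_union_right

theorem sum_le_of_setSubeq [CompactSpace X] [T2Space X] [ContinuousConstSMul G X]
    (μ : InvRegPremeasure X G) {A B : List (Set X)} (hA : ∀ s ∈ A, IsOpen s)
    (hB : ∀ s ∈ B, IsOpen s) (h : SetSubeq G A B) : (A.map μ.m).sum ≤ (B.map μ.m).sum := by
  have key : ∀ C : List (Set X), (C.map μ.m).sum = ∑ i, μ.m (C.get i) := by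
    intro C
    rw [← List.sum_ofFn]
    congr 1
    conv_lhs => rw [← List.ofFn_get C, List.map_ofFn]
    rfl
  rw [key, key]
  exact μ.sum_le_of_famSubeq (fun i => hA _ (List.get_mem _ _)) (fun k => hB _ (List.get_mem _ _))
    (setSubeq_iff_famSubeq.1 h)

end InvRegPremeasure

end Premeasure

section Separation

/-- The open sets bounded by a multiple of `y`. -/
def IsDominated (G : Type*) [Group G] [MulAction G X] (y : Multiset (Set X)) (O : Set X) : Prop :=
  IsOpen O ∧ ∃ m : ℕ, MSubeq G {O} (m • y)

theorem IsCompact.exists_finset_translates [ContinuousConstSMul G X] {κ : Type*} {B : κ → Set X} (hB : ∀ j, IsOpen (B j))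
    {K : Set X} (hK : IsCompact K) (hKB : K ⊆ ⋃ g : G, g • ⋃ j, B j) :
    ∃ T : Finset (G × κ), K ⊆ ⋃ t ∈ T, t.1 • B t.2 := by
  refine hK.elim_finite_subcover (fun t : G × κ => t.1 • B t.2) (fun t => (hB _).smul _)
    fun x hx => ?_
  obtain ⟨g, hg⟩ := Set.mem_iUnion.1 (hKB hx)
  rw [Set.smul_set_iUnion] at hg
  obtain ⟨j, hj⟩ := Set.mem_iUnion.1 hg
  exact Set.mem_iUnion.2 ⟨(g, j), hj⟩

theorem Multiset.map_val_sum_singleton {α β : Type*} [Fintype β] {p : α → Prop} {C : β → α}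
    (hC : ∀ b, p (C b)) :
    (∑ b, ({⟨C b, hC b⟩} : Multiset {a // p a})).map Subtype.val = ∑ b, {C b} := by
  rw [← Multiset.coe_mapAddMonoidHom, map_sum]
  simp

variable [CompactSpace X] [T2Space X] [ContinuousConstSMul G X]

namespace IsDominated

variable {y : Multiset (Set X)}

theorem union (hy : ∀ s ∈ y, IsOpen s) {O O' : Set X} (h : IsDominated G y O)
    (h' : IsDominated G y O') : IsDominated G y (O ∪ O') := by
  obtain ⟨hO, m, hm⟩ := h
  obtain ⟨hO', m', hm'⟩ := h'
  refine ⟨hO.union hO', m + m', (MSubeq.union_add hO hO').trans ?_⟩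
  rw [add_nsmul]
  exact MSubeq.add (by simpa using hO) (fun s hs => hy s (Multiset.mem_of_mem_nsmul hs))
    (by simpa using hO') (fun s hs => hy s (Multiset.mem_of_mem_nsmul hs)) hm hm'

theorem of_smul_subset {O O' : Set X} (h : IsDominated G y O) (hO' : IsOpen O') (g : G)
    (hg : g • O' ⊆ O) : IsDominated G y O' :=
  ⟨hO', h.2.imp fun _ hm => (MSubeq.of_smul_subset hO' h.1 g hg).trans hm⟩

theorem of_subset {O O' : Set X} (h : IsDominated G y O) (hO' : IsOpen O') (hs : O' ⊆ O) :
    IsDominated G y O' :=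
  h.of_smul_subset hO' 1 (by simpa using hs)

theorem smul {O : Set X} (h : IsDominated G y O) (g : G) : IsDominated G y (g • O) :=
  h.of_smul_subset (h.1.smul g) g⁻¹ (by simp)

theorem of_mem (hy : ∀ s ∈ y, IsOpen s) {O : Set X} (hO : O ∈ y) : IsDominated G y O := by
  obtain ⟨z, rfl⟩ := Multiset.exists_cons_of_mem hO
  refine ⟨hy O hO, 1, ?_⟩
  have hz : ∀ s ∈ z, IsOpen s := fun s hs => hy s (Multiset.mem_cons_of_mem hs)
  have := MSubeq.add (G := G) (u := {O}) (v := {O}) (u' := 0) (v' := z) (by simpa using hy O hO)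
    (by simpa using hy O hO) (by simp) hz (MSubeq.refl (by simpa using hy O hO)) (MSubeq.zero z)
  simpa using this

theorem biUnion (hy : ∀ s ∈ y, IsOpen s) {ι : Type*} (T : Finset ι) {O : ι → Set X}
    (hO : ∀ t ∈ T, IsDominated G y (O t)) : IsDominated G y (⋃ t ∈ T, O t) := by
  classical
  induction T using Finset.induction_on with
  | empty => exact ⟨by simp, 0, by simpa using MSubeq.empty_zero⟩
  | insert t T _ ih =>
    rw [Finset.set_biUnion_insert]
    exact union hy (hO t (Finset.mem_insert_self t T))
      (ih fun s hs => hO s (Finset.mem_insert_of_mem hs))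

theorem exists_nsmul (hy : ∀ s ∈ y, IsOpen s) (w : Multiset (Set X))
    (hw : ∀ s ∈ w, IsDominated G y s) : ∃ n : ℕ, MSubeq G w (n • y) := by
  induction w using Multiset.induction_on with
  | empty => exact ⟨0, MSubeq.zero _⟩
  | cons O w ih =>
    obtain ⟨n, hn⟩ := ih fun s hs => hw s (Multiset.mem_cons_of_mem hs)
    obtain ⟨hO, m, hm⟩ := hw O (Multiset.mem_cons_self O w)
    refine ⟨m + n, ?_⟩
    rw [add_nsmul, ← Multiset.singleton_add]
    exact MSubeq.add (by simpa using hO) (fun s hs => hy s (Multiset.mem_of_mem_nsmul hs))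
      (fun s hs => (hw s (Multiset.mem_cons_of_mem hs)).1)
      (fun s hs => hy s (Multiset.mem_of_mem_nsmul hs)) hm hn

end IsDominated

/-- If no inequality `(n + 1) [A] ≤ n [B]` holds, then some additive functional on the open sets
dominated by `B` is normalized at `B` and at least `1` at `A`. -/
theorem exists_isOpenContent {ι κ : Type*} [Fintype ι] [Fintype κ] {A : ι → Set X} {B : κ → Set X}
    (hB : ∀ j, IsOpen (B j)) (hA : ∀ i, IsDominated G (∑ j, {B j}) (A i))
    (h : ∀ n : ℕ, 0 < n → ¬ MSubeq G ((n + 1) • ∑ i, {A i}) (n • ∑ j, {B j})) :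
    ∃ d : Set X → ℝ≥0,
      IsOpenContent G (⋃ g : G, g • ⋃ j, B j) (IsDominated G (∑ j, {B j})) d ∧
      ∑ j, d (B j) = 1 ∧ 1 ≤ ∑ i, d (A i) := by
  classical
  set y : Multiset (Set X) := ∑ j, {B j} with hy_def
  have hmem : ∀ s, s ∈ y ↔ ∃ j, B j = s := fun s => by
    simp [hy_def, Multiset.mem_sum, eq_comm]
  have hy : ∀ s ∈ y, IsOpen s := fun s hs => by
    obtain ⟨j, rfl⟩ := (hmem s).1 hs
    exact hB j
  have hBy : ∀ j, IsDominated G y (B j) := fun j => .of_mem hy ((hmem _).2 ⟨j, rfl⟩)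
  let S := {O : Set X // IsDominated G y O}
  let r : Multiset S → Multiset S → Prop := fun u v =>
    MSubeq G (u.map Subtype.val) (v.map Subtype.val)
  have hopen : ∀ u : Multiset S, ∀ s ∈ u.map Subtype.val, IsOpen s := fun u s hs => by
    obtain ⟨t, -, rfl⟩ := Multiset.mem_map.1 hs
    exact t.2.1
  have hmA := Multiset.map_val_sum_singleton hA
  have hmB := Multiset.map_val_sum_singleton hBy
  obtain ⟨D, hmono, hDy, hDx⟩ := exists_state_one_le (r := r) (fun u => MSubeq.refl (hopen u))
    (fun _ _ _ => MSubeq.trans)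
    (fun u v u' v' huv huv' => by
      simp only [r, Multiset.map_add]
      exact MSubeq.add (hopen _) (hopen _) (hopen _) (hopen _) huv huv')
    (fun u => by simpa [r] using MSubeq.zero _)
    (∑ i, {⟨A i, hA i⟩}) (∑ j, {⟨B j, hBy j⟩})
    (fun w => by
      simp only [r, Multiset.map_nsmul]
      rw [hmB]
      refine IsDominated.exists_nsmul hy _ fun s hs => ?_
      obtain ⟨t, -, rfl⟩ := Multiset.mem_map.1 hs
      exact t.2)
    (fun n hn => by
      simp only [r, Multiset.map_nsmul]
      rw [hmA, hmB]
      exact h n hn)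
  have hD0 : ∀ u, 0 ≤ D u := fun u => by
    simpa using hmono 0 u (by simpa [r] using MSubeq.zero _)
  let d : Set X → ℝ≥0 := fun O => if hO : IsDominated G y O then (D {⟨O, hO⟩}).toNNReal else 0
  have hd : ∀ O (hO : IsDominated G y O), (d O : ℝ) = D {⟨O, hO⟩} := fun O hO => by
    simp [d, hO, hD0]
  refine ⟨d, ⟨fun O hO => hO.1, fun K hKU hK => ?_, fun O O' hO hO' hs => hO.of_subset hO' hs,
    fun O O' hO hO' => hO.union hy hO', fun O O' hO hO' hs => ?_, fun O O' hO hO' => ?_,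
    fun O O₁ O₂ hO h₁ h₂ hs₁ hs₂ hdisj => ?_, fun g O hO => hO.smul g, fun g O hO => ?_⟩, ?_, ?_⟩
  · obtain ⟨T, hT⟩ := hK.exists_finset_translates hB hKU
    exact ⟨_, .biUnion hy T fun t _ => (hBy t.2).smul t.1, hT⟩
  · have hP := hO.of_subset hO' hs
    rw [← NNReal.coe_le_coe, hd _ hO, hd _ hP]
    exact hmono _ _ (by simpa [r] using MSubeq.of_subset hO' hO.1 hs)
  · rw [← NNReal.coe_le_coe, NNReal.coe_add, hd _ hO, hd _ hO', hd _ (hO.union hy hO'), ← map_add]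
    exact hmono _ _ (by simpa [r] using MSubeq.union_add hO.1 hO'.1)
  · have hP₁ := hO.of_subset h₁ hs₁
    have hP₂ := hO.of_subset h₂ hs₂
    rw [← NNReal.coe_le_coe, NNReal.coe_add, hd _ hO, hd _ hP₁, hd _ hP₂, ← map_add]
    exact hmono _ _ (by simpa [r] using MSubeq.add_of_disjoint h₁ h₂ hO.1 hdisj hs₁ hs₂)
  · rw [← NNReal.coe_le_coe, hd _ hO, hd _ (hO.smul g)]
    exact hmono _ _ (by
      simpa [r] using MSubeq.of_smul_subset (hO.smul g).1 hO.1 g⁻¹ (by simp))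
  · rw [← NNReal.coe_inj, NNReal.coe_sum, NNReal.coe_one, ← hDy, map_sum]
    exact Finset.sum_congr rfl fun j _ => hd _ _
  · rw [← NNReal.coe_le_coe, NNReal.coe_sum, NNReal.coe_one]
    refine hDx.trans_eq ?_
    rw [map_sum]
    exact Finset.sum_congr rfl fun i _ => (hd _ _).symm

/-- If no inequality `(n + 1) [A] ≤ n [B]` holds, then some invariant premeasure normalized at `B`
is at least `1` at any compact enlargement of `A`. -/
theorem exists_premeasure_of_forall_not_mSubeq [SecondCountableTopology X] {ι κ : Type*}
    [Fintype ι] [Fintype κ] {A K : ι → Set X} {B : κ → Set X}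
    (hB : ∀ j, IsOpen (B j)) (hA : ∀ i, IsOpen (A i)) (hK : ∀ i, IsCompact (K i))
    (hAK : ∀ i, A i ⊆ K i) (hKB : ∀ i, K i ⊆ ⋃ g : G, g • ⋃ j, B j)
    (h : ∀ n : ℕ, 0 < n → ¬ MSubeq G ((n + 1) • ∑ i, {A i}) (n • ∑ j, {B j})) :
    ∃ μ : InvRegPremeasure X G, ∑ j, μ.m (B j) = 1 ∧ 1 ≤ ∑ i, μ.m (K i) := by
  let _ : MeasurableSpace X := borel X
  have _ : BorelSpace X := ⟨rfl⟩
  set U : Set X := ⋃ g : G, g • ⋃ j, B j with hU_def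
  have hUo : IsOpen U := isOpen_iUnion fun g => (isOpen_iUnion hB).smul g
  have hU : ∀ g : G, g • U ⊆ U := fun g => by
    rw [hU_def, Set.smul_set_iUnion]
    refine Set.iUnion_subset fun s => ?_
    rw [smul_smul]
    exact Set.subset_iUnion (fun s : G => s • ⋃ j, B j) (g * s)
  have hBU : ∀ j, B j ⊆ U := fun j =>
    (Set.subset_iUnion B j).trans (by
      simpa using Set.subset_iUnion (fun s : G => s • ⋃ j, B j) 1)
  have hy : ∀ s ∈ ∑ j, ({B j} : Multiset (Set X)), IsOpen s := fun s hs => by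
    obtain ⟨j, -, hj⟩ := Multiset.mem_sum.1 hs
    rw [Multiset.mem_singleton.1 hj]
    exact hB j
  have hBy : ∀ j, IsDominated G (∑ j, {B j}) (B j) := fun j =>
    .of_mem hy (Multiset.mem_sum.2 ⟨j, Finset.mem_univ j, Multiset.mem_singleton_self _⟩)
  have hAy : ∀ i, IsDominated G (∑ j, {B j}) (A i) := fun i => by
    obtain ⟨T, hT⟩ := (hK i).exists_finset_translates hB (hKB i)
    exact (IsDominated.biUnion hy T fun t _ => (hBy t.2).smul t.1).of_subset (hA i)
      ((hAK i).trans hT)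
  obtain ⟨d, hd, hdB, hdA⟩ := exists_isOpenContent hB hAy h
  rw [← hU_def] at hd
  obtain ⟨ν, hreg, hν, hle, hge⟩ := hd.exists_measure hUo hU
  set c : ℝ≥0∞ := ∑ j, ν (Subtype.val ⁻¹' B j) with hc
  have hc1 : c ≤ 1 := by
    calc c ≤ ∑ j, (d (B j) : ℝ≥0∞) := Finset.sum_le_sum fun j _ => hle _ (hBy j)
      _ = 1 := by exact_mod_cast hdB
  have hνK : 1 ≤ ∑ i, ν (Subtype.val ⁻¹' K i) := by
    calc (1 : ℝ≥0∞) ≤ ∑ i, (d (A i) : ℝ≥0∞) := by exact_mod_cast hdA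
      _ ≤ _ := Finset.sum_le_sum fun i _ => hge _ _ (hAy i) (hK i) (hAK i) (hKB i)
  have hc0 : c ≠ 0 := by
    intro h0
    have hB0 : ∀ j, ν (Subtype.val ⁻¹' B j) = 0 := fun j =>
      (Finset.sum_eq_zero_iff.1 h0) j (Finset.mem_univ j)
    have hK0 : ∀ i, ν (Subtype.val ⁻¹' K i) = 0 := fun i => by
      obtain ⟨T, hT⟩ := (hK i).exists_finset_translates hB (hKB i)
      refine MeasureTheory.measure_mono_null (Set.preimage_mono hT) ?_
      rw [Set.preimage_iUnion₂]
      refine (MeasureTheory.measure_biUnion_null_iff T.countable_toSet).2 fun t _ => ?_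
      rw [hν _ _ (hB t.2).measurableSet, hB0]
    simp [hK0] at hνK
  have hcinv : c⁻¹ ≠ ∞ := ENNReal.inv_ne_top.2 hc0
  have hcinv1 : 1 ≤ c⁻¹ := ENNReal.one_le_inv.2 hc1
  have : (c⁻¹ • ν).Regular := MeasureTheory.Measure.Regular.smul hcinv
  obtain ⟨μ, hμ⟩ := exists_premeasure hUo hU (c⁻¹ • ν) fun g s hs => by
    simp [hν g s hs]
  refine ⟨μ, ?_, ?_⟩
  · simp only [hμ _ (hB _).inAlg (hBU _), MeasureTheory.Measure.smul_apply, smul_eq_mul,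
      ← Finset.mul_sum]
    exact ENNReal.inv_mul_cancel hc0 (hc1.trans_lt ENNReal.one_lt_top).ne
  · simp only [hμ _ (hK _).isClosed.inAlg (hKB _), MeasureTheory.Measure.smul_apply, smul_eq_mul,
      ← Finset.mul_sum]
    exact one_le_mul hcinv1 hνK

end Separation

section Tuples

open scoped Topology

theorem isOpen_osupp (f : C(X, ℝ≥0)) : IsOpen (osupp f) :=
  isOpen_ne_fun f.continuous continuous_const

theorem osupp_cutFun (f : C(X, ℝ≥0)) (ε : ℝ≥0) : osupp (cutFun f ε) = {x | ε < f x} := by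
  ext x
  simp [osupp, cutFun, tsub_eq_zero_iff_le]

theorem coe_ofFn_eq_sum {α : Type*} {n : ℕ} (A : Fin n → α) :
    ((List.ofFn A : List α) : Multiset α) = ∑ i, {A i} := by
  rw [← Fin.univ_val_map, ← Multiset.sum_map_singleton (Multiset.map A _), Multiset.map_map]
  rfl

theorem SetSubeq.subset_iUnion_smul {A B : List (Set X)} [T1Space X] (h : SetSubeq G A B) {s : Set X}
    (hs : s ∈ A) : s ⊆ ⋃ g : G, g • ⋃ t ∈ B, t := by
  classical
  intro x hx
  obtain ⟨i, rfl⟩ := List.mem_iff_get.1 hs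
  obtain ⟨T, -, p, U, g, k, -, hcov, hsub, -⟩ := setSubeq_iff_famSubeq.1 h
    (Function.update (fun _ => ∅) i {x}) fun j => by
      rcases eq_or_ne j i with rfl | hj
      · simpa using hx
      · simp [hj]
  obtain ⟨q, -, hq⟩ := hcov i x (by simp)
  refine Set.mem_iUnion.2 ⟨(g q)⁻¹, Set.mem_inv_smul_set_iff.2 ?_⟩
  exact Set.mem_biUnion (List.get_mem B (k q)) (hsub q (Set.smul_mem_smul_set hq))

/-- Subequivalence may be checked on all cut-downs. -/
theorem FamSubeq.of_forall_cutFun [CompactSpace X] {ι κ : Type*} [Finite ι] {f : ι → C(X, ℝ≥0)}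
    {B : κ → Set X} (h : ∀ ε : ℝ≥0, 0 < ε → FamSubeq G (fun i => osupp (cutFun (f i) ε)) B) :
    FamSubeq G (fun i => osupp (f i)) B := by
  intro F hF
  have key : ∀ i, ∀ᶠ ε in 𝓝[>] (0 : ℝ≥0), F i ⊆ osupp (cutFun (f i) ε) := by
    intro i
    rcases (F i).eq_empty_or_nonempty with hemp | hne
    · simp [hemp]
    obtain ⟨x, hx, hmin⟩ := (hF i).1.isCompact.exists_isMinOn hne (f i).continuous.continuousOn
    have hpos : 0 < f i x := pos_iff_ne_zero.2 ((hF i).2 hx)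
    filter_upwards [Ioo_mem_nhdsGT hpos] with ε hε z hz
    rw [osupp_cutFun]
    exact hε.2.trans_le (hmin hz)
  obtain ⟨ε, hε, hpos⟩ := ((Filter.eventually_all.2 key).and self_mem_nhdsWithin).exists
  exact h ε hpos F fun i => ⟨(hF i).1, hε i⟩

theorem setSubeq_ofFn_iff {k l : ℕ} {A : Fin k → Set X} {B : Fin l → Set X} :
    SetSubeq G (List.ofFn A) (List.ofFn B) ↔ FamSubeq G A B := by
  have key : ∀ {n : ℕ} (C : Fin n → Set X),
      (List.ofFn C).get = C ∘ finCongr List.length_ofFn := fun C => by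
    ext1 i
    simp [Fin.cast]
  rw [setSubeq_iff_famSubeq, key, key]
  refine ⟨fun h => ?_, fun h => h.reindex _ _⟩
  have := h.reindex (finCongr List.length_ofFn).symm (finCongr List.length_ofFn).symm
  simpa only [Function.comp_assoc, Equiv.self_comp_symm, Function.comp_id] using this

end Tuples

/-- **Theorem 3.9.** For fixed `k, l ∈ ℕ`, the following are equivalent:
(i) for all `a ∈ C(X)₊^k`, `b ∈ C(X)₊^l`, if `(n+1)[a] ≤ n[b]` in `W(X, G)` for some
`n ∈ ℕ⁺` then `[a] ≤ [b]`;
(ii) for all such `a, b` with `Aᵢ = supp fᵢ`, `Bⱼ = supp gⱼ`, if `⋃ᵢ Aᵢ ⊆ G ⋅ (⋃ⱼ Bⱼ)`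
and `Σᵢ μ(Aᵢ) < Σⱼ μ(Bⱼ)` for every `μ ∈ Pr_G(X)` with `Σⱼ μ(Bⱼ) = 1`, then `a ≼ b`. -/
theorem almost_unperforation_iff_comparison_tuples {X : Type*} [TopologicalSpace X]
    [CompactSpace X] [T2Space X] [TopologicalSpace.MetrizableSpace X]
    {G : Type*} [Group G] [MulAction G X]
    (hG : ∀ g : G, Continuous fun x : X => g • x) (k l : ℕ) :
    (∀ (f : Fin k → C(X, ℝ≥0)) (g : Fin l → C(X, ℝ≥0)),
      (∃ n : ℕ, 0 < n ∧ DynSubeq G (List.flatten (List.replicate (n + 1) (List.ofFn f)))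
        (List.flatten (List.replicate n (List.ofFn g)))) →
      DynSubeq G (List.ofFn f) (List.ofFn g)) ↔
    (∀ (f : Fin k → C(X, ℝ≥0)) (g : Fin l → C(X, ℝ≥0)),
      ((⋃ i, osupp (f i)) ⊆ ⋃ s : G, s • ⋃ j, osupp (g j)) →
      (∀ μ : InvRegPremeasure X G, (∑ j, μ.m (osupp (g j))) = 1 →
        (∑ i, μ.m (osupp (f i))) < ∑ j, μ.m (osupp (g j))) →
      DynSubeq G (List.ofFn f) (List.ofFn g)) := by
  have _ : ContinuousConstSMul G X := ⟨hG⟩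
  have _ : SecondCountableTopology X := by
    let _ := TopologicalSpace.metrizableSpaceMetric X
    infer_instance
  have hopen : ∀ {m : ℕ} (h : Fin m → C(X, ℝ≥0)), ∀ s ∈ List.ofFn (fun i => osupp (h i)),
      IsOpen s := fun h s hs => by
    obtain ⟨i, rfl⟩ := List.mem_ofFn.1 hs
    exact isOpen_osupp _
  have hrep : ∀ {m : ℕ} (h : Fin m → C(X, ℝ≥0)) (n : ℕ),
      (List.replicate n (List.ofFn h)).flatten.map osupp =
        (List.replicate n (List.ofFn fun i => osupp (h i))).flatten := fun h n => by
    rw [List.map_flatten, List.map_replicate, List.map_ofFn]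
    rfl
  constructor
  · intro H f g hfg hμ
    rw [DynSubeq, List.map_ofFn, List.map_ofFn]
    refine setSubeq_ofFn_iff.2 (FamSubeq.of_forall_cutFun fun ε hε => ?_)
    rw [← setSubeq_ofFn_iff]
    have key := H (fun i => cutFun (f i) ε) g
    simp only [DynSubeq, List.map_ofFn] at key
    refine key ?_
    by_contra! hcon
    have hK : ∀ i, {x | ε ≤ f i x} ⊆ osupp (f i) := fun i x hx => (hε.trans_le hx).ne'
    obtain ⟨μ, hμg, hμf⟩ := exists_premeasure_of_forall_not_mSubeq (G := G)
      (A := fun i => osupp (cutFun (f i) ε)) (K := fun i => {x | ε ≤ f i x})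
      (B := fun j => osupp (g j)) (fun j => isOpen_osupp _) (fun i => isOpen_osupp _)
      (fun i => (isClosed_le continuous_const (f i).continuous).isCompact)
      (fun i x hx => by
        rw [osupp_cutFun] at hx
        rw [Set.mem_ofPred_eq] at hx ⊢
        exact hx.le)
      (fun i => ((hK i).trans (Set.subset_iUnion (fun i => osupp (f i)) i)).trans hfg)
      (fun n hn => by
        rw [← coe_ofFn_eq_sum, ← coe_ofFn_eq_sum,
          MSubeq.nsmul_iff (hopen fun i => cutFun (f i) ε) (hopen g), ← hrep, ← hrep]
        exact hcon n hn)
    refine absurd ((hμ μ hμg).trans_eq hμg) (not_lt.2 (hμf.trans ?_))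
    exact Finset.sum_le_sum fun i _ => μ.m_mono
      (isClosed_le continuous_const (f i).continuous).inAlg (isOpen_osupp _).inAlg (hK i)
  · rintro H f g ⟨n, hn, h⟩
    rw [DynSubeq, hrep, hrep] at h
    have hmem : ∀ {m : ℕ} (a : Fin m → C(X, ℝ≥0)) (n : ℕ),
        ∀ s ∈ (List.replicate n (List.ofFn fun i => osupp (a i))).flatten,
          ∃ i, osupp (a i) = s := fun a n s hs => by
      obtain ⟨L, hL, hs⟩ := List.mem_flatten.1 hs
      rw [(List.mem_replicate.1 hL).2] at hs
      simpa using hs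
    have hsum : ∀ (μ : InvRegPremeasure X G) {m : ℕ} (a : Fin m → C(X, ℝ≥0)) (n : ℕ),
        ((List.replicate n (List.ofFn fun i => osupp (a i))).flatten.map μ.m).sum =
          n * ∑ i, μ.m (osupp (a i)) := fun μ m a n => by
      rw [List.map_flatten, List.sum_flatten, List.map_replicate, List.map_replicate,
        List.sum_replicate, List.map_ofFn, List.sum_ofFn, nsmul_eq_mul]
      rfl
    refine H f g (Set.iUnion_subset fun i => ?_) fun μ hμ => ?_
    · refine (h.subset_iUnion_smul (s := osupp (f i)) ?_).trans
        (Set.iUnion_mono fun s => Set.smul_set_mono (Set.iUnion₂_subset fun t ht => ?_))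
      · simp [List.replicate_succ]
      · obtain ⟨j, rfl⟩ := hmem g n t ht
        exact Set.subset_iUnion (fun j => osupp (g j)) j
    · have hle := μ.sum_le_of_setSubeq
        (fun s hs => by
          obtain ⟨i, rfl⟩ := hmem f _ s hs
          exact isOpen_osupp _)
        (fun s hs => by
          obtain ⟨j, rfl⟩ := hmem g _ s hs
          exact isOpen_osupp _) h
      rw [hsum, hsum, hμ, mul_one] at hle
      rw [hμ]
      by_contra! hge
      have h1 : ((n + 1 : ℕ) : ℝ≥0∞) ≤ n :=
        (le_mul_of_one_le_right zero_le hge).trans hle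
      exact absurd (Nat.cast_le.1 h1) (by omega)
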